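/- Let n ∈ ℕ, let K be a singular, strictly concave and strictly monotone (SM) kernel function, let J be an upper semicontinuous n-field function, and let r₁,…,rₙ > 0. If y ∈ S̄ is a maximum point of m̲ over S̄, i.e., m̲(y) = sup_{x ∈ S̄} m̲(x), then y belongs to the regularity set Y (in particular y ∈ S) and y is an equioscillation point, i.e., m₀(y) = m₁(y) = ⋯ = mₙ(y). -/

import Mathlib

open Set Filter

noncomputable section

/-- A kernel function: `ℝ ∪ {−∞}`-valued (modeled as `EReal`, never `⊤`),
finite and concave on `(-1,0)` and `(0,1)`, extended continuously to `[-1,1]`. -/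
structure IsKernel (K : ℝ → EReal) : Prop where
  ne_top : ∀ t, K t ≠ ⊤
  finite_off_zero : ∀ t ∈ Ioo (-1:ℝ) 1, t ≠ 0 → K t ≠ ⊥
  concave_neg : ConcaveOn ℝ (Ioo (-1:ℝ) 0) (fun t => (K t).toReal)
  concave_pos : ConcaveOn ℝ (Ioo (0:ℝ) 1) (fun t => (K t).toReal)
  lim_zero_left : Tendsto K (nhdsWithin 0 (Iio 0)) (nhds (K 0))
  lim_zero_right : Tendsto K (nhdsWithin 0 (Ioi 0)) (nhds (K 0))
  lim_neg_one : Tendsto K (nhdsWithin (-1) (Ioi (-1))) (nhds (K (-1)))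
  lim_one : Tendsto K (nhdsWithin 1 (Iio 1)) (nhds (K 1))

/-- Singularity condition `(∞)`: `K(0) = −∞`. -/
def SingularKernel (K : ℝ → EReal) : Prop := K 0 = ⊥

/-- Monotonicity condition (M). -/
def MonotoneKernel (K : ℝ → EReal) : Prop :=
  AntitoneOn K (Ioo (-1:ℝ) 0) ∧ MonotoneOn K (Ioo (0:ℝ) 1)

/-- Strict monotonicity condition (SM). -/
def StrictMonotoneKernel (K : ℝ → EReal) : Prop :=
  StrictAntiOn K (Ico (-1:ℝ) 0) ∧ StrictMonoOn K (Ioc (0:ℝ) 1)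

/-- Strict concavity of a kernel function. -/
def StrictConcaveKernel (K : ℝ → EReal) : Prop :=
  StrictConcaveOn ℝ (Ioo (-1:ℝ) 0) (fun t => (K t).toReal) ∧
  StrictConcaveOn ℝ (Ioo (0:ℝ) 1) (fun t => (K t).toReal)

/-- An `n`-field function: bounded above, never `+∞`, finite on a set of weighted
cardinality exceeding `n` (interior points of `[0,1]` count `1`, the endpoints `1/2`). -/
def IsFieldFn (n : ℕ) (J : ℝ → EReal) : Prop :=
  (∀ t, J t ≠ ⊤) ∧ (∃ M : ℝ, ∀ t ∈ Icc (0:ℝ) 1, J t ≤ (M : EReal)) ∧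
  ∃ T : Finset ℝ, (T : Set ℝ) ⊆ Icc (0:ℝ) 1 ∧ (∀ t ∈ T, J t ≠ ⊥) ∧
    (n : ℝ) < ∑ t ∈ T, (if t = 0 ∨ t = 1 then (1/2 : ℝ) else 1)

/-- The closed simplex `S̄`. -/
def closedSimplex (n : ℕ) : Set (Fin n → ℝ) :=
  {y | Monotone y ∧ ∀ j, y j ∈ Icc (0:ℝ) 1}

/-- The open simplex `S`. -/
def openSimplex (n : ℕ) : Set (Fin n → ℝ) :=
  {y | StrictMono y ∧ ∀ j, y j ∈ Ioo (0:ℝ) 1}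

/-- Extended nodes: `y₀ = 0`, `y_{n+1} = 1`. -/
def extNode {n : ℕ} (y : Fin n → ℝ) (j : Fin (n + 2)) : ℝ :=
  if _h0 : (j : ℕ) = 0 then 0
  else if _hn : (j : ℕ) ≤ n then y ⟨(j : ℕ) - 1, by omega⟩
  else 1

/-- The interval `I_j(y) = [y_j, y_{j+1}]`, `j = 0, …, n`. -/
def nodeInterval {n : ℕ} (y : Fin n → ℝ) (j : Fin (n + 1)) : Set ℝ :=
  Icc (extNode y j.castSucc) (extNode y j.succ)

/-- The sum of translates function `F(y,t) = J(t) + ∑ⱼ rⱼ K(t - yⱼ)`. -/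
def sumTrans {n : ℕ} (r : Fin n → ℝ) (K J : ℝ → EReal) (y : Fin n → ℝ) (t : ℝ) : EReal :=
  J t + ∑ j, (r j : EReal) * K (t - y j)

/-- The interval maximum `m_j(y) = sup_{t ∈ I_j(y)} F(y,t)`. -/
def mj {n : ℕ} (r : Fin n → ℝ) (K J : ℝ → EReal) (j : Fin (n + 1)) (y : Fin n → ℝ) : EReal :=
  sSup (sumTrans r K J y '' nodeInterval y j)

/-- `m̄(y) = max_j m_j(y)`. -/
def mbar {n : ℕ} (r : Fin n → ℝ) (K J : ℝ → EReal) (y : Fin n → ℝ) : EReal :=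
  ⨆ j, mj r K J j y

/-- `m̲(y) = min_j m_j(y)`. -/
def munder {n : ℕ} (r : Fin n → ℝ) (K J : ℝ → EReal) (y : Fin n → ℝ) : EReal :=
  ⨅ j, mj r K J j y

/-- The regularity set `Y`. -/
def regSet {n : ℕ} (r : Fin n → ℝ) (K J : ℝ → EReal) : Set (Fin n → ℝ) :=
  {y ∈ openSimplex n | ∀ j, mj r K J j y ≠ ⊥}

/-- Equioscillation: all interval maxima agree. -/
def Equioscillation {n : ℕ} (r : Fin n → ℝ) (K J : ℝ → EReal) (y : Fin n → ℝ) : Prop :=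
  ∀ i j : Fin (n + 1), mj r K J i y = mj r K J j y

section ExtNode

variable {n : ℕ}

lemma extNode_zero (y : Fin n → ℝ) : extNode y 0 = 0 := by simp [extNode]

lemma extNode_last (y : Fin n → ℝ) : extNode y (Fin.last (n + 1)) = 1 := by simp [extNode]

lemma extNode_of_val_eq (y : Fin n → ℝ) (j : Fin (n + 2)) (i : Fin n)
    (h : (j : ℕ) = i + 1) : extNode y j = y i := by
  have h0 : (j : ℕ) ≠ 0 := by omega
  have h1 : (j : ℕ) ≤ n := by omega
  simp only [extNode, h0, h1, dite_true, dite_false]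
  congr 1
  ext
  simp [h]

lemma extNode_cases (y : Fin n → ℝ) (j : Fin (n + 2)) :
    j = 0 ∨ j = Fin.last (n + 1) ∨ ∃ i : Fin n, (j : ℕ) = i + 1 ∧ extNode y j = y i := by
  by_cases h0 : (j : ℕ) = 0
  · left; ext; simpa using h0
  · by_cases h1 : (j : ℕ) = n + 1
    · right; left; ext; simpa using h1
    · refine .inr (.inr ⟨⟨j - 1, by omega⟩, ?_, extNode_of_val_eq _ _ _ ?_⟩) <;> simp <;> omega

lemma extNode_strictMono {y : Fin n → ℝ} (hy : y ∈ openSimplex n) : StrictMono (extNode y) := by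
  intro a b hab
  have hab' : (a : ℕ) < b := hab
  rcases extNode_cases y a with rfl | rfl | ⟨i, hi, hia⟩ <;>
    rcases extNode_cases y b with rfl | rfl | ⟨i', hi', hib⟩
  · exact absurd hab (lt_irrefl _)
  · simp [extNode_zero, extNode_last]
  · rw [extNode_zero, hib]; exact (hy.2 i').1
  · simp at hab'
  · exact absurd hab (lt_irrefl _)
  · simp at hab'; omega
  · simp at hab'
  · rw [extNode_last, hia]; exact (hy.2 i).2
  · rw [hia, hib]; exact hy.1 (Fin.lt_def.2 (by omega))

lemma mem_openSimplex_of_extNode_strictMono {y : Fin n → ℝ} (h : StrictMono (extNode y)) :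
    y ∈ openSimplex n := by
  have key : ∀ i : Fin n, extNode y i.succ.castSucc = y i := fun i =>
    extNode_of_val_eq _ _ _ (by simp)
  refine ⟨fun a b hab => ?_, fun i => ⟨?_, ?_⟩⟩
  · rw [← key, ← key]; exact h (by simpa using hab)
  · rw [← key, ← extNode_zero y]; exact h (Fin.lt_def.2 (by simp))
  · rw [← key, ← extNode_last y]; exact h (Fin.lt_def.2 (by simp))

lemma openSimplex_subset_closedSimplex : openSimplex n ⊆ closedSimplex n :=
  fun _ hy => ⟨hy.1.monotone, fun j => Ioo_subset_Icc_self (hy.2 j)⟩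

lemma isOpen_openSimplex : IsOpen (openSimplex n) := by
  have : openSimplex n = (⋂ (a : Fin n) (b : Fin n) (_ : a < b), {y : Fin n → ℝ | y a < y b}) ∩
      ⋂ a : Fin n, {y : Fin n → ℝ | y a ∈ Ioo (0 : ℝ) 1} := by
    ext y
    simp [openSimplex, StrictMono]
  rw [this]
  refine IsOpen.inter ?_ ?_
  · refine isOpen_iInter_of_finite fun a => isOpen_iInter_of_finite fun b =>
      isOpen_iInter_of_finite fun _ => isOpen_lt (by fun_prop) (by fun_prop)
  · exact isOpen_iInter_of_finite fun a => isOpen_Ioo.preimage (continuous_apply a)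

lemma nodeInterval_subset {y : Fin n → ℝ} (hy : y ∈ openSimplex n) (j : Fin (n + 1)) :
    nodeInterval y j ⊆ Icc 0 1 := by
  have h := (extNode_strictMono hy).monotone
  refine Icc_subset_Icc ?_ ?_
  · rw [← extNode_zero y]; exact h (Fin.zero_le _)
  · rw [← extNode_last y]; exact h (Fin.le_last _)

/-- A non-nodal point of `I_j(y)` stays in `I_j` under small perturbations of the nodes. -/
lemma eventually_mem_nodeInterval {y : Fin n → ℝ} {j : Fin (n + 1)} {t : ℝ}
    (ht : t ∈ nodeInterval y j) (hty : ∀ i, t ≠ y i) (ht01 : t ∈ Icc (0 : ℝ) 1) :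
    ∀ᶠ x in nhds y, t ∈ nodeInterval x j := by
  have h1 : ∀ᶠ x in nhds y, extNode x j.castSucc ≤ t := by
    rcases extNode_cases y j.castSucc with h | h | ⟨i, hi, h⟩
    · simp [h, extNode_zero, ht01.1]
    · exact absurd h (Fin.castSucc_lt_last j).ne
    · have hlt : y i < t := lt_of_le_of_ne (h ▸ ht.1) (hty i).symm
      filter_upwards [(continuous_apply i).continuousAt.eventually_lt_const hlt] with x hx
      rw [extNode_of_val_eq x _ i hi]; exact hx.le
  have h2 : ∀ᶠ x in nhds y, t ≤ extNode x j.succ := by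
    rcases extNode_cases y j.succ with h | h | ⟨i, hi, h⟩
    · exact absurd h (Fin.succ_ne_zero j)
    · simp [h, extNode_last, ht01.2]
    · have hlt : t < y i := lt_of_le_of_ne (h ▸ ht.2) (hty i)
      filter_upwards [(continuous_apply i).continuousAt.eventually_const_lt hlt] with x hx
      rw [extNode_of_val_eq x _ i hi]; exact hx.le
  filter_upwards [h1, h2] with x hx1 hx2 using ⟨hx1, hx2⟩

end ExtNode

section Kernel

variable {K J : ℝ → EReal}

lemma IsKernel.continuousOn_toReal_neg (hK : IsKernel K) :
    ContinuousOn (fun t => (K t).toReal) (Ioo (-1 : ℝ) 0) :=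
  hK.concave_neg.continuousOn isOpen_Ioo

lemma IsKernel.continuousOn_toReal_pos (hK : IsKernel K) :
    ContinuousOn (fun t => (K t).toReal) (Ioo (0 : ℝ) 1) :=
  hK.concave_pos.continuousOn isOpen_Ioo

lemma IsKernel.continuousAt_toReal (hK : IsKernel K) {t : ℝ} (ht : t ∈ Ioo (-1 : ℝ) 1)
    (h0 : t ≠ 0) : ContinuousAt (fun t => (K t).toReal) t := by
  rcases h0.lt_or_gt with h | h
  · exact hK.continuousOn_toReal_neg.continuousAt (isOpen_Ioo.mem_nhds ⟨ht.1, h⟩)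
  · exact hK.continuousOn_toReal_pos.continuousAt (isOpen_Ioo.mem_nhds ⟨h, ht.2⟩)

lemma IsKernel.coe_toReal (hK : IsKernel K) {t : ℝ} (ht : t ∈ Ioo (-1 : ℝ) 1)
    (h0 : t ≠ 0) : ((K t).toReal : EReal) = K t :=
  EReal.coe_toReal (hK.ne_top t) (hK.finite_off_zero t ht h0)

lemma IsKernel.continuousAt (hK : IsKernel K) {t : ℝ} (ht : t ∈ Ioo (-1 : ℝ) 1) :
    ContinuousAt K t := by
  by_cases h0 : t = 0
  · subst h0
    exact continuousAt_iff_continuous_left'_right'.2 ⟨hK.lim_zero_left, hK.lim_zero_right⟩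
  · have h : ContinuousAt (fun s => ((K s).toReal : EReal)) t :=
      continuous_coe_real_ereal.continuousAt.comp (hK.continuousAt_toReal ht h0)
    refine h.congr ?_
    filter_upwards [isOpen_Ioo.mem_nhds ht, isOpen_ne.mem_nhds h0] with s hs hs0
    exact hK.coe_toReal hs hs0

lemma coe_mul_ne_top {c : ℝ} (hc : 0 < c) {x : EReal} (hx : x ≠ ⊤) : (c : EReal) * x ≠ ⊤ := by
  induction x with
  | bot => simp [EReal.coe_mul_bot_of_pos hc]
  | coe a => rw [← EReal.coe_mul]; exact EReal.coe_ne_top _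
  | top => exact absurd rfl hx

lemma EReal.finset_sum_ne_top {ι : Type*} (s : Finset ι) {f : ι → EReal}
    (h : ∀ i ∈ s, f i ≠ ⊤) : ∑ i ∈ s, f i ≠ ⊤ := by
  classical
  induction s using Finset.induction_on with
  | empty => simp
  | insert a s ha ih =>
    rw [Finset.sum_insert ha]
    exact EReal.add_ne_top (h a (by simp)) (ih fun i hi => h i (by simp [hi]))

lemma EReal.finset_sum_eq_bot {ι : Type*} (s : Finset ι) {f : ι → EReal} {i : ι} (hi : i ∈ s)
    (h : f i = ⊥) : ∑ i ∈ s, f i = ⊥ := by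
  classical
  rw [← Finset.add_sum_erase s f hi, h, EReal.bot_add]

lemma EReal.coe_finset_sum {ι : Type*} (s : Finset ι) (f : ι → ℝ) :
    ((∑ i ∈ s, f i : ℝ) : EReal) = ∑ i ∈ s, (f i : EReal) := by
  classical
  induction s using Finset.induction_on with
  | empty => simp
  | insert a s ha ih => rw [Finset.sum_insert ha, Finset.sum_insert ha, EReal.coe_add, ih]

lemma EReal.continuousAt_finset_sum {ι X : Type*} [TopologicalSpace X] (s : Finset ι)
    {f : ι → X → EReal} {x : X} (htop : ∀ i ∈ s, f i x ≠ ⊤) (h : ∀ i ∈ s, ContinuousAt (f i) x) :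
    ContinuousAt (fun z => ∑ i ∈ s, f i z) x := by
  classical
  induction s using Finset.induction_on with
  | empty => simpa using continuousAt_const
  | insert a s ha ih =>
    simp_rw [Finset.sum_insert ha]
    have h1 := ih (fun i hi => htop i (by simp [hi])) (fun i hi => h i (by simp [hi]))
    have h2 := EReal.finset_sum_ne_top s (fun i hi => htop i (by simp [hi]))
    exact ContinuousAt.comp (f := fun z => (f a z, ∑ i ∈ s, f i z))
      (EReal.continuousAt_add (.inl (htop a (by simp))) (.inr h2))
      ((h a (by simp)).prodMk h1)

variable {n : ℕ} {r : Fin n → ℝ}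

lemma sub_mem_Ioo_neg_one_one {y t : ℝ} (hy : y ∈ Ioo (0 : ℝ) 1) (ht : t ∈ Icc (0 : ℝ) 1) :
    t - y ∈ Ioo (-1 : ℝ) 1 := ⟨by linarith [hy.2, ht.1], by linarith [hy.1, ht.2]⟩

lemma sumTrans_eq_coe (hK : IsKernel K) {y : Fin n → ℝ} (hy : y ∈ openSimplex n) {t : ℝ}
    (ht : t ∈ Icc (0 : ℝ) 1) (hty : ∀ i, t ≠ y i) (hJ : J t ≠ ⊤) (hJ' : J t ≠ ⊥) :
    sumTrans r K J y t =
      (((J t).toReal + ∑ i, r i * (K (t - y i)).toReal : ℝ) : EReal) := by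
  rw [EReal.coe_add, EReal.coe_toReal hJ hJ', EReal.coe_finset_sum, sumTrans]
  congr 1
  refine Finset.sum_congr rfl fun i _ => ?_
  rw [EReal.coe_mul, hK.coe_toReal (sub_mem_Ioo_neg_one_one (hy.2 i) ht)
    (sub_ne_zero.2 (hty i))]

lemma sumTrans_node (hsing : SingularKernel K) (hr : ∀ j, 0 < r j) (y : Fin n → ℝ) (i : Fin n) :
    sumTrans r K J y (y i) = ⊥ := by
  rw [sumTrans, EReal.finset_sum_eq_bot _ (Finset.mem_univ i), EReal.add_bot]
  rw [sub_self, hsing, EReal.coe_mul_bot_of_pos (hr i)]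

lemma upperSemicontinuousOn_sumTrans (hK : IsKernel K) (hr : ∀ j, 0 < r j)
    (hJ : ∀ t, J t ≠ ⊤) (hJusc : UpperSemicontinuousOn J (Icc (0 : ℝ) 1))
    {y : Fin n → ℝ} (hy : y ∈ openSimplex n) :
    UpperSemicontinuousOn (sumTrans r K J y) (Icc (0 : ℝ) 1) := by
  have htop : ∀ t, ∀ i : Fin n, (r i : EReal) * K (t - y i) ≠ ⊤ := fun t i =>
    coe_mul_ne_top (hr i) (hK.ne_top _)
  have hsum : ∀ t, ∑ i, (r i : EReal) * K (t - y i) ≠ ⊤ := fun t =>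
    EReal.finset_sum_ne_top _ fun i _ => htop t i
  refine hJusc.add' (ContinuousOn.upperSemicontinuousOn fun t ht => ?_) fun t _ =>
    EReal.continuousAt_add (.inl (hJ t)) (.inr (hsum t))
  refine (EReal.continuousAt_finset_sum Finset.univ (f := fun i s => (r i : EReal) * K (s - y i))
    (fun i _ => htop t i) fun i _ => ?_).continuousWithinAt
  have hc : ContinuousAt (fun s => K (s - y i)) t :=
    ContinuousAt.comp (g := K) (hK.continuousAt (sub_mem_Ioo_neg_one_one (hy.2 i) ht))
      (by fun_prop)
  exact EReal.Tendsto.const_mul hc (.inl (EReal.coe_ne_bot _)) (.inl (EReal.coe_ne_top _))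

end Kernel

section IntervalMaxima

variable {n : ℕ} {r : Fin n → ℝ} {K J : ℝ → EReal}

lemma exists_sumTrans_ne_bot {y : Fin n → ℝ} {j : Fin (n + 1)} (h : mj r K J j y ≠ ⊥) :
    ∃ t ∈ nodeInterval y j, sumTrans r K J y t ≠ ⊥ := by
  by_contra! hc
  refine h (le_bot_iff.1 (sSup_le ?_))
  rintro _ ⟨t, ht, rfl⟩
  exact (hc t ht).le

lemma le_mj {y : Fin n → ℝ} {j : Fin (n + 1)} {t : ℝ} (ht : t ∈ nodeInterval y j) :
    sumTrans r K J y t ≤ mj r K J j y :=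
  le_sSup ⟨t, ht, rfl⟩

lemma ne_node_of_sumTrans_ne_bot (hsing : SingularKernel K) (hr : ∀ j, 0 < r j)
    {y : Fin n → ℝ} {t : ℝ} (h : sumTrans r K J y t ≠ ⊥) (i : Fin n) : t ≠ y i := by
  rintro rfl
  exact h (sumTrans_node hsing hr y i)

lemma mem_openSimplex_of_mj_ne_bot (hn : 0 < n) (hsing : SingularKernel K) (hr : ∀ j, 0 < r j)
    {y : Fin n → ℝ} (h : ∀ j, mj r K J j y ≠ ⊥) : y ∈ openSimplex n := by
  refine mem_openSimplex_of_extNode_strictMono (Fin.strictMono_iff_lt_succ.2 fun j => ?_)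
  obtain ⟨t, ht, hF⟩ := exists_sumTrans_ne_bot (h j)
  have hne := ne_node_of_sumTrans_ne_bot hsing hr hF
  refine lt_of_le_of_ne (ht.1.trans ht.2) fun heq => ?_
  have h1 : t = extNode y j.castSucc := le_antisymm (heq ▸ ht.2) ht.1
  have h2 : t = extNode y j.succ := h1.trans heq
  by_cases hj : (j : ℕ) = 0
  · exact hne ⟨0, hn⟩ (h2.trans (extNode_of_val_eq _ _ _ (by simp [hj])))
  · exact hne ⟨j - 1, by omega⟩ (h1.trans (extNode_of_val_eq _ _ _ (by simp; omega)))

lemma exists_sumTrans_eq_mj (hK : IsKernel K) (hr : ∀ j, 0 < r j)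
    (hJ : ∀ t, J t ≠ ⊤) (hJusc : UpperSemicontinuousOn J (Icc (0 : ℝ) 1))
    {y : Fin n → ℝ} (hy : y ∈ openSimplex n) (j : Fin (n + 1)) :
    ∃ t ∈ nodeInterval y j, sumTrans r K J y t = mj r K J j y := by
  have hne : (nodeInterval y j).Nonempty :=
    nonempty_Icc.2 ((extNode_strictMono hy).monotone (Fin.castSucc_lt_succ).le)
  obtain ⟨t, ht, hmax⟩ := UpperSemicontinuousOn.exists_isMaxOn hne isCompact_Icc
    ((upperSemicontinuousOn_sumTrans hK hr hJ hJusc hy).mono (nodeInterval_subset hy j))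
  refine ⟨t, ht, le_antisymm (le_mj ht) (sSup_le ?_)⟩
  rintro _ ⟨s, hs, rfl⟩
  exact hmax hs

lemma lt_munder_iff {y : Fin n → ℝ} {c : EReal} :
    c < munder r K J y ↔ ∀ j, c < mj r K J j y := by
  refine ⟨fun h j => h.trans_le (iInf_le _ j), fun h => ?_⟩
  obtain ⟨j, hj⟩ := exists_eq_ciInf_of_finite (f := fun j => mj r K J j y)
  rw [munder, ← hj]
  exact h j

lemma exists_finset_card_of_isFieldFn (hJ : IsFieldFn n J) :
    ∃ T : Finset ℝ, (T : Set ℝ) ⊆ Icc (0 : ℝ) 1 ∧ (∀ t ∈ T, J t ≠ ⊥) ∧ n + 1 ≤ T.card := by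
  obtain ⟨-, -, T, hT, hTJ, hc⟩ := hJ
  refine ⟨T, hT, hTJ, ?_⟩
  have h : ∑ t ∈ T, (if t = 0 ∨ t = 1 then (1/2 : ℝ) else 1) ≤ ∑ t ∈ T, (1 : ℝ) :=
    Finset.sum_le_sum fun t _ => by split_ifs <;> norm_num
  have h' : (n : ℝ) < T.card := by simpa using hc.trans_le h
  exact_mod_cast h'

lemma exists_munder_ne_bot (hK : IsKernel K) (hJ : IsFieldFn n J) :
    ∃ x ∈ closedSimplex n, ⊥ < munder r K J x := by
  obtain ⟨T, hT, hTJ, hcard⟩ := exists_finset_card_of_isFieldFn hJ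
  let e := T.orderEmbOfCardLe hcard
  have heT : ∀ j, e j ∈ T := T.orderEmbOfCardLe_mem hcard
  have he01 : ∀ j, e j ∈ Icc (0 : ℝ) 1 := fun j => hT (heT j)
  let x : Fin n → ℝ := fun i => (e i.castSucc + e i.succ) / 2
  have hlt : ∀ i : Fin n, e i.castSucc < e i.succ := fun i =>
    e.strictMono Fin.castSucc_lt_succ
  have hbelow : ∀ (j : Fin (n + 1)) (i : Fin n), (j : ℕ) ≤ i → e j < x i := fun j i h => by
    have : e j ≤ e i.castSucc := e.monotone (Fin.le_def.2 (by simpa using h))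
    simp only [x]; linarith [hlt i]
  have habove : ∀ (j : Fin (n + 1)) (i : Fin n), (i : ℕ) < j → x i < e j := fun j i h => by
    have : e i.succ ≤ e j := e.monotone (Fin.le_def.2 (by simpa using h))
    simp only [x]; linarith [hlt i]
  have hx : x ∈ openSimplex n := by
    refine ⟨fun a b hab => ?_, fun i => ⟨?_, ?_⟩⟩
    · exact (habove a.succ a (by simp)).trans_le (hbelow a.succ b (by simpa using hab)).le
    · exact (he01 0).1.trans_lt (hbelow 0 i (by simp))
    · exact (habove (Fin.last n) i (by simp)).trans_le (he01 _).2
  have hne : ∀ j i, e j ≠ x i := fun j i => by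
    rcases le_or_gt (j : ℕ) i with h | h
    · exact (hbelow j i h).ne
    · exact (habove j i h).ne'
  refine ⟨x, openSimplex_subset_closedSimplex hx, lt_munder_iff.2 fun j => ?_⟩
  have hmem : e j ∈ nodeInterval x j := by
    constructor
    · rcases extNode_cases x j.castSucc with h | h | ⟨i, hi, h⟩
      · rw [h, extNode_zero]; exact (he01 j).1
      · exact absurd h (Fin.castSucc_lt_last j).ne
      · rw [h]; exact (habove j i (by simp at hi; omega)).le
    · rcases extNode_cases x j.succ with h | h | ⟨i, hi, h⟩
      · exact absurd h (Fin.succ_ne_zero j)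
      · rw [h, extNode_last]; exact (he01 j).2
      · rw [h]; exact (hbelow j i (by simp at hi; omega)).le
  refine lt_of_lt_of_le ?_ (le_mj hmem)
  rw [sumTrans_eq_coe hK hx (he01 j) (hne j) (hJ.1 _) (hTJ _ (heT j))]
  exact EReal.bot_lt_coe _

end IntervalMaxima

section Perturbation

variable {n : ℕ} {r : Fin n → ℝ} {K J : ℝ → EReal}

/-- Moving two points towards each other, with displacements inversely proportional to the
weights, increases the weighted sum of the values of a strictly concave function. -/
lemma StrictConcaveOn.weighted_sum_lt {s : Set ℝ} {f : ℝ → ℝ} (hf : StrictConcaveOn ℝ s f)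
    {a b c d p q ε : ℝ} (ha : a ∈ s) (hd : d ∈ s) (hab : a < b) (hbc : b < c) (hcd : c < d)
    (hε : 0 < ε) (hp : p * (d - c) = ε) (hq : q * (b - a) = ε) :
    p * f d + q * f a < p * f c + q * f b := by
  have hb : b ∈ s := hf.1.ordConnected.out ha hd ⟨hab.le, (hbc.trans hcd).le⟩
  have h1 := hf.slope_anti_adjacent ha (hf.1.ordConnected.out ha hd ⟨(hab.trans hbc).le, hcd.le⟩)
    hab hbc
  have h2 := hf.slope_anti_adjacent hb hd hbc hcd
  have h3 := h2.trans h1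
  have hdc : 0 < d - c := sub_pos.2 hcd
  have hba : 0 < b - a := sub_pos.2 hab
  have hp' : p = ε / (d - c) := by field_simp; exact hp
  have hq' : q = ε / (b - a) := by field_simp; exact hq
  have h4 : p * (f d - f c) < q * (f b - f a) := by
    have := mul_lt_mul_of_pos_left h3 hε
    rw [hp', hq']
    calc ε / (d - c) * (f d - f c) = ε * ((f d - f c) / (d - c)) := by ring
      _ < ε * ((f b - f a) / (b - a)) := this
      _ = _ := by ring
  linarith

lemma lt_node_of_mem {y : Fin n → ℝ} (hy : y ∈ openSimplex n) {j : Fin (n + 1)} {t : ℝ}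
    (ht : t ∈ nodeInterval y j) {i : Fin n} (hti : t ≠ y i) (hji : (j : ℕ) ≤ i) : t < y i := by
  refine lt_of_le_of_ne (ht.2.trans ?_) hti
  rw [← extNode_of_val_eq y i.succ.castSucc i (by simp)]
  exact (extNode_strictMono hy).monotone (Fin.le_def.2 (by simpa using hji))

lemma node_lt_of_mem {y : Fin n → ℝ} (hy : y ∈ openSimplex n) {j : Fin (n + 1)} {t : ℝ}
    (ht : t ∈ nodeInterval y j) {i : Fin n} (hti : t ≠ y i) (hij : (i : ℕ) < j) : y i < t := by
  refine lt_of_le_of_ne (le_trans ?_ ht.1) hti.symm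
  rw [← extNode_of_val_eq y i.succ.castSucc i (by simp)]
  exact (extNode_strictMono hy).monotone (Fin.le_def.2 (by simpa using hij))

/-- The direction which moves the endpoints of `I_k` towards each other. -/
def shrinkDir (r : Fin n → ℝ) (k : Fin (n + 1)) (i : Fin n) : ℝ :=
  (if (i : ℕ) + 1 = k then 1 / r i else 0) - (if (i : ℕ) = k then 1 / r i else 0)

/-- Shrinking `I_k` strictly increases the sum of translates off `I_k`. -/
lemma sum_lt_sum_of_shrink (hn : 0 < n) (hK : IsKernel K) (hsc : StrictConcaveKernel K)
    (hsm : StrictMonotoneKernel K) (hr : ∀ j, 0 < r j) {x y : Fin n → ℝ}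
    (hx : x ∈ openSimplex n) (hy : y ∈ openSimplex n) {k j : Fin (n + 1)} (hjk : j ≠ k) {ε : ℝ}
    (hε : 0 < ε) (hxy : ∀ i, x i = y i + ε * shrinkDir r k i) {t : ℝ} (ht : t ∈ Icc (0 : ℝ) 1)
    (hty : t ∈ nodeInterval y j) (hny : ∀ i, t ≠ y i) :
    ∑ i, r i * (K (t - y i)).toReal < ∑ i, r i * (K (t - x i)).toReal := by
  have hjk' : (j : ℕ) ≠ k := fun h => hjk (Fin.ext h)
  have hIx := fun i => sub_mem_Ioo_neg_one_one (hx.2 i) ht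
  have hIy := fun i => sub_mem_Ioo_neg_one_one (hy.2 i) ht
  have hstill : ∀ i : Fin n, (i : ℕ) + 1 ≠ k → (i : ℕ) ≠ k → x i = y i := fun i h1 h2 => by
    simp [hxy, shrinkDir, h1, h2]
  have hright : ∀ i : Fin n, (i : ℕ) + 1 = k → r i * (x i - y i) = ε := fun i h1 => by
    have h2 : (i : ℕ) ≠ k := by omega
    have := (hr i).ne'
    simp only [hxy, shrinkDir, h1, h2, if_true, if_false]
    field_simp
    ring
  have hleft : ∀ i : Fin n, (i : ℕ) = k → r i * (y i - x i) = ε := fun i h2 => by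
    have h1 : (i : ℕ) + 1 ≠ k := by omega
    have := (hr i).ne'
    rw [hxy, shrinkDir, if_neg h1, if_pos h2]
    field_simp
    ring
  have hright' : ∀ i : Fin n, (i : ℕ) + 1 = k → y i < x i := fun i h => by
    have := pos_of_mul_pos_right ((hright i h).symm ▸ hε) (hr i).le
    linarith
  have hleft' : ∀ i : Fin n, (i : ℕ) = k → x i < y i := fun i h => by
    have := pos_of_mul_pos_right ((hleft i h).symm ▸ hε) (hr i).le
    linarith
  have htoReal : ∀ u v : ℝ, u ∈ Ioo (-1 : ℝ) 1 → v ∈ Ioo (-1 : ℝ) 1 → u ≠ 0 → v ≠ 0 →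
      K u < K v → (K u).toReal < (K v).toReal := fun u v hu hv hu0 hv0 h => by
    rwa [← hK.coe_toReal hu hu0, ← hK.coe_toReal hv hv0, EReal.coe_lt_coe_iff] at h
  rw [← sub_pos, ← Finset.sum_sub_distrib]
  have hzero : ∀ i : Fin n, (i : ℕ) + 1 ≠ k → (i : ℕ) ≠ k →
      r i * (K (t - x i)).toReal - r i * (K (t - y i)).toReal = 0 := fun i h1 h2 => by
    rw [hstill i h1 h2, sub_self]
  by_cases hk0 : (k : ℕ) = 0
  · let b : Fin n := ⟨0, hn⟩
    rw [Fintype.sum_eq_single b fun i hi => hzero i (by omega)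
      fun h => hi (Fin.ext (by simp [b, h, hk0]))]
    have hyb : y b < t := node_lt_of_mem hy hty (hny b)
      (show 0 < (j : ℕ) by omega)
    have hxb : x b < y b := hleft' b (by simp [b, hk0])
    rw [← mul_sub]
    refine mul_pos (hr b) (sub_pos.2 (htoReal _ _ (hIy b) (hIx b) (by linarith) (by linarith) ?_))
    exact hsm.2 ⟨by linarith, (hIy b).2.le⟩ ⟨by linarith, (hIx b).2.le⟩ (by linarith)
  by_cases hkn : (k : ℕ) = n
  · let a : Fin n := ⟨k - 1, by omega⟩
    have hak : (a : ℕ) + 1 = k := by simp [a]; omega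
    rw [Fintype.sum_eq_single a fun i hi => hzero i
      (fun h => hi (Fin.ext (by omega))) (by omega)]
    have hta : t < y a := lt_node_of_mem hy hty (hny a) (by omega)
    have hxa : y a < x a := hright' a hak
    rw [← mul_sub]
    refine mul_pos (hr a) (sub_pos.2 (htoReal _ _ (hIy a) (hIx a) (by linarith) (by linarith) ?_))
    exact hsm.1 ⟨(hIx a).1.le, by linarith⟩ ⟨(hIy a).1.le, by linarith⟩ (by linarith)
  · let a : Fin n := ⟨k - 1, by omega⟩
    let b : Fin n := ⟨k, by omega⟩
    have hak : (a : ℕ) + 1 = k := by simp [a]; omega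
    have hbk : (b : ℕ) = k := rfl
    have hab : a < b := Fin.lt_def.2 (by omega)
    rw [Fintype.sum_eq_add a b hab.ne fun i hi => hzero i
      (fun h => hi.1 (Fin.ext (by omega))) (fun h => hi.2 (Fin.ext (by omega)))]
    have hya := hright' a hak
    have hyb := hleft' b hbk
    have hxab := hx.1 hab
    have hra := hright a hak
    have hrb := hleft b hbk
    have key : ∀ s : Set ℝ, StrictConcaveOn ℝ s (fun u => (K u).toReal) →
        t - y b ∈ s → t - y a ∈ s →
        0 < r a * (K (t - x a)).toReal - r a * (K (t - y a)).toReal +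
          (r b * (K (t - x b)).toReal - r b * (K (t - y b)).toReal) := fun s hs hb ha => by
      have := hs.weighted_sum_lt (b := t - x b) (c := t - x a) (p := r a) (q := r b) hb ha
        (by linarith) (by linarith) (by linarith) hε (by linarith) (by linarith)
      linarith
    rcases hjk'.lt_or_gt with h | h
    · have hta := lt_node_of_mem hy hty (hny a) (by omega)
      have htb := lt_node_of_mem hy hty (hny b) (by omega)
      exact key _ hsc.1 ⟨(hIy b).1, by linarith⟩ ⟨(hIy a).1, by linarith⟩
    · have hta := node_lt_of_mem hy hty (hny a) (by omega)
      have htb := node_lt_of_mem hy hty (hny b) (by omega)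
      exact key _ hsc.2 ⟨by linarith, (hIy b).2⟩ ⟨by linarith, (hIy a).2⟩

lemma continuousAt_sum_translates (hK : IsKernel K) {y : Fin n → ℝ} (hy : y ∈ openSimplex n)
    {t : ℝ} (ht : t ∈ Icc (0 : ℝ) 1) (hny : ∀ i, t ≠ y i) :
    ContinuousAt (fun x : Fin n → ℝ => ∑ i, r i * (K (t - x i)).toReal) y := by
  refine tendsto_finsetSum _ fun i _ => Tendsto.const_mul _ ?_
  exact ContinuousAt.comp (g := fun u => (K u).toReal) (f := fun x : Fin n → ℝ => t - x i)
    (hK.continuousAt_toReal (sub_mem_Ioo_neg_one_one (hy.2 i) ht) (sub_ne_zero.2 (hny i)))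
    (continuousAt_const.sub (continuous_apply i).continuousAt)

/-- If some interval maximum exceeds `m̲(y)`, then `m̲` is not maximal at `y`. -/
lemma exists_munder_lt (hn : 0 < n) (hr : ∀ j, 0 < r j) (hK : IsKernel K)
    (hsing : SingularKernel K) (hsc : StrictConcaveKernel K) (hsm : StrictMonotoneKernel K)
    (hJ : ∀ t, J t ≠ ⊤) (hJusc : UpperSemicontinuousOn J (Icc (0 : ℝ) 1))
    {y : Fin n → ℝ} (hy : y ∈ regSet r K J) {k : Fin (n + 1)}
    (hk : munder r K J y < mj r K J k y) :
    ∃ x ∈ closedSimplex n, munder r K J y < munder r K J x := by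
  obtain ⟨hyS, hreg⟩ := hy
  choose t htI htF using exists_sumTrans_eq_mj hK hr hJ hJusc hyS
  have hF : ∀ j, sumTrans r K J y (t j) ≠ ⊥ := fun j => htF j ▸ hreg j
  have hny : ∀ j i, t j ≠ y i := fun j => ne_node_of_sumTrans_ne_bot hsing hr (hF j)
  have ht01 : ∀ j, t j ∈ Icc (0 : ℝ) 1 := fun j => nodeInterval_subset hyS j (htI j)
  have hJt : ∀ j, J (t j) ≠ ⊥ := fun j h => hF j (by rw [sumTrans, h, EReal.bot_add])
  have hyk := sumTrans_eq_coe (r := r) hK hyS (ht01 k) (hny k) (hJ _) (hJt k)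
  rw [← htF k, hyk] at hk
  have hcont : ∀ᶠ x in nhds y, munder r K J y <
      (((J (t k)).toReal + ∑ i, r i * (K (t k - x i)).toReal : ℝ) : EReal) :=
    (continuous_coe_real_ereal.continuousAt.comp (continuousAt_const.add
      (continuousAt_sum_translates hK hyS (ht01 k) (hny k)))).eventually_const_lt hk
  have hmem : ∀ᶠ x in nhds y, ∀ j, t j ∈ nodeInterval x j :=
    eventually_all.2 fun j => eventually_mem_nodeInterval (htI j) (hny j) (ht01 j)
  have hnx : ∀ᶠ x in nhds y, ∀ j i, t j ≠ x i :=
    eventually_all.2 fun j => eventually_all.2 fun i =>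
      ((continuous_apply i).continuousAt.eventually_ne (hny j i).symm).mono fun _ h => h.symm
  have hlim : Tendsto (fun ε : ℝ => y + ε • shrinkDir r k) (nhdsWithin 0 (Ioi 0)) (nhds y) := by
    have : ContinuousAt (fun ε : ℝ => y + ε • shrinkDir r k) 0 := by fun_prop
    simpa using this.tendsto.mono_left nhdsWithin_le_nhds
  obtain ⟨ε, ⟨⟨⟨hxc, hxm⟩, hxn⟩, hxS⟩, hε⟩ :=
    ((hlim.eventually (((hcont.and hmem).and hnx).and
      (isOpen_openSimplex.mem_nhds hyS))).and self_mem_nhdsWithin).exists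
  refine ⟨_, openSimplex_subset_closedSimplex hxS, lt_munder_iff.2 fun j => ?_⟩
  refine lt_of_lt_of_le ?_ (le_mj (hxm j))
  rw [sumTrans_eq_coe hK hxS (ht01 j) (hxn j) (hJ _) (hJt j)]
  by_cases hjk : j = k
  · exact hjk ▸ hxc
  · refine lt_of_le_of_lt ((iInf_le _ j).trans_eq (htF j).symm) ?_
    rw [sumTrans_eq_coe hK hyS (ht01 j) (hny j) (hJ _) (hJt j), EReal.coe_lt_coe_iff]
    exact add_lt_add_right (sum_lt_sum_of_shrink hn hK hsc hsm hr hxS hyS hjk hε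
      (fun i => by simp) (ht01 j) (htI j) (hny j)) _

end Perturbation

theorem statement8 (n : ℕ) (hn : 0 < n) (r : Fin n → ℝ) (hr : ∀ j, 0 < r j)
    (K J : ℝ → EReal) (hK : IsKernel K)
    (hsing : SingularKernel K) (hsc : StrictConcaveKernel K) (hsm : StrictMonotoneKernel K)
    (hJ : IsFieldFn n J) (hJusc : UpperSemicontinuousOn J (Icc (0:ℝ) 1))
    (y : Fin n → ℝ) (hy : y ∈ closedSimplex n)
    (hmax : munder r K J y = ⨆ x ∈ closedSimplex n, munder r K J x) :
    y ∈ regSet r K J ∧ Equioscillation r K J y := by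
  have hle : ∀ x ∈ closedSimplex n, munder r K J x ≤ munder r K J y := fun x hx =>
    hmax ▸ le_iSup₂ (f := fun x (_ : x ∈ closedSimplex n) => munder r K J x) x hx
  obtain ⟨x₀, hx₀, hpos⟩ := exists_munder_ne_bot (r := r) hK hJ
  have hne : ∀ j, mj r K J j y ≠ ⊥ := fun j =>
    (lt_munder_iff.1 (hpos.trans_le (hle x₀ hx₀)) j).ne'
  have hreg : y ∈ regSet r K J := ⟨mem_openSimplex_of_mj_ne_bot hn hsing hr hne, hne⟩
  refine ⟨hreg, ?_⟩
  have heq : ∀ j, mj r K J j y = munder r K J y := fun j => by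
    refine le_antisymm (not_lt.1 fun hlt => ?_) (iInf_le _ j)
    obtain ⟨x, hx, hlt'⟩ := exists_munder_lt hn hr hK hsing hsc hsm hJ.1 hJusc hreg hlt
    exact (hle x hx).not_gt hlt'
  exact fun i j => (heq i).trans (heq j).symm
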